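/- Let (a,b) and (c,d) be arcs in 𝒜 with a < c ≤ b < d, and let 0 → M_{(a,b)} → B → M_{(c,d)} → 0 be any non-split short exact sequence of graded S-modules with degree-0 maps. Then B is isomorphic, via a degree-0 isomorphism, to M_{(c,b)} ⊕ M_{(a,d)} (where M_{(c,b)} is interpreted as the zero module if c = b). -/

import Mathlib

/-- `𝒵 = ℤ ∪ {−∞}`. -/
abbrev Zb := WithBot ℤ

universe u

noncomputable section

/-- A `ℤ`-graded module over `S = k[y]` (`y` of degree `1`), presented as a representation of
the companion category: a family of `k`-vector spaces `V i` (the degree-`i` homogeneous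
components) together with the action of `y`, raising degrees by one. -/
structure GrMod (k : Type u) [Field k] where
  V : ℤ → Type u
  [acg : ∀ i, AddCommGroup (V i)]
  [mod : ∀ i, Module k (V i)]
  act : ∀ i, V i →ₗ[k] V (i + 1)

attribute [instance] GrMod.acg GrMod.mod

variable (k : Type u) [Field k]

/-- The degree-`i` component of the graded module `M_{(a,b)}` attached to a pair `(a,b)`:
it is `k` when `a < −i ≤ b` and `0` otherwise.  (For an arc `a < b` with `a,b ∈ ℤ` this is
the module `S/(y^{b−a})(b)`, generated in degree `−b`; for `a = −∞` it is `S(b)`; if `a = b`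
it is the zero module.) -/
def arcComp (a b : Zb) (i : ℤ) : Submodule k k :=
  if a < ((-i : ℤ) : Zb) ∧ ((-i : ℤ) : Zb) ≤ b then ⊤ else ⊥

/-- The graded module `M_{(a,b)}`: for integers `a < b` this is `S/(y^{b−a})(b)`, for
`a = −∞` it is the twisted free module `S(b)`, and for `a = b` it is the zero module.
The action of `y` is the canonical one (the identity of `k` whenever source and target
components are both nonzero). -/
def arcMod (a b : Zb) : GrMod k where
  V i := ↥(arcComp k a b i)
  act i := by
    classical
    exact if h : arcComp k a b (i + 1) = ⊤ then
      LinearMap.codRestrict _ (arcComp k a b i).subtype (fun x => by rw [h]; trivial)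
    else 0

/-- A family of degree-wise linear maps is a (degree-0) morphism of graded modules if it
commutes with the action of `y`. -/
def IsGrHom (M N : GrMod k) (f : ∀ i, M.V i →ₗ[k] N.V i) : Prop :=
  ∀ i, (N.act i).comp (f i) = (f (i + 1)).comp (M.act i)

/-- The `k`-vector space `Hom_{gr S}(M, N)` of degree-0 graded module homomorphisms. -/
def grHom (M N : GrMod k) : Submodule k (∀ i, M.V i →ₗ[k] N.V i) where
  carrier := {f | IsGrHom k M N f}
  add_mem' := by
    intro f g hf hg i
    simp only [Pi.add_apply, LinearMap.comp_add, LinearMap.add_comp, hf i, hg i]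
  zero_mem' := by
    intro i
    simp only [Pi.zero_apply, LinearMap.comp_zero, LinearMap.zero_comp]
  smul_mem' := by
    intro c f hf i
    simp only [Pi.smul_apply, LinearMap.comp_smul, LinearMap.smul_comp, hf i]

/-- An isomorphism of graded modules: a family of degree-wise linear equivalences commuting
with the action of `y`. -/
structure GrIso (M N : GrMod k) where
  e : ∀ i, M.V i ≃ₗ[k] N.V i
  comm : ∀ (i : ℤ) (x : M.V i), N.act i (e i x) = e (i + 1) (M.act i x)

/-- The kernel of a morphism of graded modules, as a graded module. -/
def kerMod (M N : GrMod k) (f : ∀ i, M.V i →ₗ[k] N.V i) (hf : IsGrHom k M N f) : GrMod k where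
  V i := ↥(LinearMap.ker (f i))
  act i := (M.act i).restrict (p := LinearMap.ker (f i)) (q := LinearMap.ker (f (i + 1)))
    (fun x hx => by
      have h := LinearMap.congr_fun (hf i) x
      simp only [LinearMap.comp_apply] at h
      simp only [LinearMap.mem_ker] at hx ⊢
      rw [← h, hx, map_zero])

/-- The cokernel of a morphism of graded modules, as a graded module. -/
def cokerMod (M N : GrMod k) (f : ∀ i, M.V i →ₗ[k] N.V i) (hf : IsGrHom k M N f) : GrMod k where
  V i := N.V i ⧸ LinearMap.range (f i)
  act i := Submodule.mapQ _ _ (N.act i) (by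
    rintro x hx
    simp only [LinearMap.mem_range] at hx
    obtain ⟨y, rfl⟩ := hx
    simp only [Submodule.mem_comap, LinearMap.mem_range]
    have h := LinearMap.congr_fun (hf i) y
    simp only [LinearMap.comp_apply] at h
    exact ⟨M.act i y, h.symm⟩)

/-- The direct sum of two graded modules. -/
def dsumMod (M N : GrMod k) : GrMod k where
  V i := M.V i × N.V i
  act i := (M.act i).prodMap (N.act i)

/-- `0 → M → B → N → 0` is a short exact sequence of graded modules (with degree-0 maps). -/
def IsGrSES (M B N : GrMod k) (ι : ∀ i, M.V i →ₗ[k] B.V i)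
    (π : ∀ i, B.V i →ₗ[k] N.V i) : Prop :=
  IsGrHom k M B ι ∧ IsGrHom k B N π ∧
    ∀ i, Function.Injective (ι i) ∧ Function.Surjective (π i) ∧
      LinearMap.ker (π i) = LinearMap.range (ι i)

/-- A short exact sequence of graded modules splits if the projection admits a degree-0
graded section. -/
def GrSplit (M B N : GrMod k) (ι : ∀ i, M.V i →ₗ[k] B.V i)
    (π : ∀ i, B.V i →ₗ[k] N.V i) : Prop :=
  ∃ σ : ∀ i, N.V i →ₗ[k] B.V i, IsGrHom k N B σ ∧ ∀ i, (π i).comp (σ i) = LinearMap.id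

end

open Classical in
/-- The indicator of the degrees in which `M_{(a,b)}` is nonzero, with values in `k`. -/
noncomputable def arcInd (k : Type u) [Field k] (a b : Zb) (i : ℤ) : k :=
  if a < ((-i : ℤ) : Zb) ∧ ((-i : ℤ) : Zb) ≤ b then 1 else 0

/-- The coordinate of a homogeneous element of `M_{(a,b)}`. -/
noncomputable def arcVal (k : Type u) [Field k] (a b : Zb) (i : ℤ) :
    (arcMod k a b).V i →ₗ[k] k :=
  (arcComp k a b i).subtype

section arc

variable {k : Type u} [Field k] {a b : Zb} {i : ℤ}

theorem arcVal_injective : Function.Injective (arcVal k a b i) :=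
  Subtype.val_injective

theorem exists_arcVal_eq (h : a < ((-i : ℤ) : Zb) ∧ ((-i : ℤ) : Zb) ≤ b) (r : k) :
    ∃ x, arcVal k a b i x = r :=
  ⟨⟨r, by rw [arcComp, if_pos h]; trivial⟩, rfl⟩

theorem arcVal_eq_zero (h : ¬(a < ((-i : ℤ) : Zb) ∧ ((-i : ℤ) : Zb) ≤ b))
    (x : (arcMod k a b).V i) : arcVal k a b i x = 0 := by
  have hx : arcVal k a b i x ∈ arcComp k a b i := Subtype.property (p := (· ∈ arcComp k a b i)) x
  rwa [arcComp, if_neg h, Submodule.mem_bot] at hx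

theorem arcVal_act (h : a < ((-(i + 1) : ℤ) : Zb) ∧ ((-(i + 1) : ℤ) : Zb) ≤ b)
    (x : (arcMod k a b).V i) :
    arcVal k a b (i + 1) ((arcMod k a b).act i x) = arcVal k a b i x := by
  have ht : arcComp k a b (i + 1) = ⊤ := if_pos h
  simp only [arcMod, arcVal, dif_pos ht]
  rfl

variable (k a b i) in
/-- The element of `M_{(a,b)}` in degree `i` with coordinate `1` if that component is nonzero,
and `0` otherwise. -/
noncomputable def arcGen : (arcMod k a b).V i :=
  ⟨arcInd k a b i, by
    unfold arcInd arcComp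
    split_ifs
    · trivial
    · exact zero_mem _⟩

theorem arcVal_gen : arcVal k a b i (arcGen k a b i) = arcInd k a b i := rfl

theorem arcVal_smul_gen (x : (arcMod k a b).V i) : arcVal k a b i x • arcGen k a b i = x := by
  apply arcVal_injective
  rw [map_smul, arcVal_gen, arcInd]
  split_ifs with h
  · simp
  · simp [arcVal_eq_zero h x]

theorem arcGen_eq_zero (h : ¬(a < ((-i : ℤ) : Zb) ∧ ((-i : ℤ) : Zb) ≤ b)) :
    arcGen k a b i = 0 :=
  arcVal_injective (by rw [arcVal_eq_zero h, map_zero])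

theorem act_arcGen (h : ((-i : ℤ) : Zb) ≤ b) :
    (arcMod k a b).act i (arcGen k a b i) = arcGen k a b (i + 1) := by
  have hlt : ((-(i + 1) : ℤ) : Zb) < ((-i : ℤ) : Zb) := WithBot.coe_lt_coe.2 (by omega)
  apply arcVal_injective
  by_cases h' : a < ((-(i + 1) : ℤ) : Zb)
  · have hc : a < ((-(i + 1) : ℤ) : Zb) ∧ ((-(i + 1) : ℤ) : Zb) ≤ b := ⟨h', hlt.le.trans h⟩
    rw [arcVal_act hc, arcVal_gen, arcVal_gen, arcInd, arcInd, if_pos hc,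
      if_pos ⟨h'.trans hlt, h⟩]
  · rw [arcVal_eq_zero (fun hc => h' hc.1), arcVal_eq_zero (fun hc => h' hc.1)]

/-- A family of elements `w i` with `y w_i = w_{i+1}` in the degrees where `M_{(a,b)}` lives, and
vanishing afterwards, defines a morphism out of `M_{(a,b)}`. -/
theorem isGrHom_arcVal_smulRight (N : GrMod k) (w : ∀ i, N.V i)
    (hw : ∀ i : ℤ, a < ((-i : ℤ) : Zb) → ((-i : ℤ) : Zb) ≤ b → N.act i (w i) = w (i + 1))
    (h0 : ∀ i : ℤ, ((-i : ℤ) : Zb) ≤ a → w i = 0) :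
    IsGrHom k (arcMod k a b) N (fun i => (arcVal k a b i).smulRight (w i)) := by
  intro i
  ext x
  have hlt : ((-(i + 1) : ℤ) : Zb) < ((-i : ℤ) : Zb) := WithBot.coe_lt_coe.2 (by omega)
  simp only [LinearMap.comp_apply, LinearMap.smulRight_apply, map_smul]
  by_cases h : a < ((-i : ℤ) : Zb) ∧ ((-i : ℤ) : Zb) ≤ b
  · rw [hw i h.1 h.2]
    by_cases h' : a < ((-(i + 1) : ℤ) : Zb)
    · rw [arcVal_act ⟨h', hlt.le.trans h.2⟩]
    · rw [h0 _ (not_lt.1 h'), smul_zero, smul_zero]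
  · have hx : x = 0 := arcVal_injective (by rw [arcVal_eq_zero h, map_zero])
    simp [hx]

end arc

/-- A homogeneous element of degree `n` extends to the family of its multiples by powers
of `y`. -/
theorem exists_orbit {k : Type u} [Field k] (B : GrMod k) (n : ℤ) (x : B.V n) :
    ∃ s : ∀ i, B.V i, s n = x ∧ ∀ i, n ≤ i → B.act i (s i) = s (i + 1) := by
  refine ⟨fun i => Int.inductionOn' i n x (fun j _ y => B.act j y) (fun _ _ _ => 0), ?_, ?_⟩
  · exact Int.inductionOn'_self
  · intro i hi
    exact (Int.inductionOn'_add_one hi).symm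

/-- A degreewise bijective morphism `M → N` yields an isomorphism `N → M`. -/
theorem nonempty_grIso_of_bijective {k : Type u} [Field k] {M N : GrMod k}
    {f : ∀ i, M.V i →ₗ[k] N.V i} (hf : IsGrHom k M N f)
    (hb : ∀ i, Function.Bijective (f i)) : Nonempty (GrIso k N M) := by
  refine ⟨⟨fun i => (LinearEquiv.ofBijective (f i) (hb i)).symm, fun i x => ?_⟩⟩
  rw [LinearEquiv.eq_symm_apply, LinearEquiv.ofBijective_apply]
  have h := LinearMap.congr_fun (hf i) ((LinearEquiv.ofBijective (f i) (hb i)).symm x)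
  simp only [LinearMap.comp_apply] at h
  rw [← h]
  congr 1
  exact LinearEquiv.apply_symm_apply (LinearEquiv.ofBijective (f i) (hb i)) x

/-- For arcs `(a,b)` and `(c,d)` with `a < c ≤ b < d`, the middle term of
any non-split short exact sequence of graded `S`-modules `0 → M_{(a,b)} → B → M_{(c,d)} → 0`
is isomorphic, via a degree-0 isomorphism, to `M_{(c,b)} ⊕ M_{(a,d)}` (with `M_{(c,b)} = 0`
if `c = b`). -/
theorem stmt4 (k : Type u) [Field k] (a b c d : Zb) (hab : a < b) (hcd : c < d)
    (h1 : a < c) (h2 : c ≤ b) (h3 : b < d)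
    (B : GrMod k) (ι : ∀ i, (arcMod k a b).V i →ₗ[k] B.V i)
    (π : ∀ i, B.V i →ₗ[k] (arcMod k c d).V i)
    (hses : IsGrSES k (arcMod k a b) B (arcMod k c d) ι π)
    (hnsplit : ¬ GrSplit k (arcMod k a b) B (arcMod k c d) ι π) :
    Nonempty (GrIso k B (dsumMod k (arcMod k c b) (arcMod k a d))) := by
  obtain ⟨hι, hπ, hex⟩ := hses
  lift c to ℤ using (bot_le.trans_lt h1).ne'
  lift b to ℤ using (bot_le.trans_lt hab).ne'
  lift d to ℤ using (bot_le.trans_lt h3).ne'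
  rw [WithBot.coe_le_coe] at h2
  rw [WithBot.coe_lt_coe] at h3 hcd
  have hac : ∀ i : ℤ, c ≤ -i → a < ((-i : ℤ) : Zb) := fun i hi =>
    h1.trans_le (WithBot.coe_le_coe.2 hi)
  have hca : ∀ i : ℤ, ((-i : ℤ) : Zb) ≤ a → -i < c := fun i hi =>
    lt_of_not_ge fun h => (hac i h).not_ge hi
  have hιact (i : ℤ) (x) : B.act i (ι i x) = ι (i + 1) ((arcMod k a b).act i x) :=
    LinearMap.congr_fun (hι i) x
  have hπact (i : ℤ) (x) : (arcMod k c d).act i (π i x) = π (i + 1) (B.act i x) :=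
    LinearMap.congr_fun (hπ i) x
  have hπι (i : ℤ) (x) : π i (ι i x) = 0 := by
    have : ι i x ∈ LinearMap.ker (π i) := (hex i).2.2 ▸ LinearMap.mem_range_self _ x
    exact this
  -- the multiples of a lift of the generator of the quotient
  obtain ⟨x, hx⟩ := (hex (-d)).2.1 (arcGen k c d (-d))
  obtain ⟨s, hsd, hs⟩ := exists_orbit B (-d) x
  have hπs : ∀ i, -d ≤ i → π i (s i) = arcGen k c d i := by
    intro i hi
    induction i, hi using Int.leInduction with
    | base => rw [hsd, hx]
    | succ i hi ih =>
      rw [← hs i hi, ← hπact, ih, act_arcGen (WithBot.coe_le_coe.2 (by omega))]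
  -- the images of the basis elements of the submodule
  let e : ∀ i, B.V i := fun i => ι i (arcGen k a b i)
  have he : ∀ i, -b ≤ i → B.act i (e i) = e (i + 1) := fun i hi => by
    rw [hιact, act_arcGen (WithBot.coe_le_coe.2 (by omega))]
  have hea : ∀ i : ℤ, ((-i : ℤ) : Zb) ≤ a → e i = 0 := fun i hi => by
    simp only [e, arcGen_eq_zero (fun h => h.1.not_ge hi), map_zero]
  have hιe : ∀ i x, ι i x = arcVal k a b i x • e i := fun i x => by
    rw [← map_smul, arcVal_smul_gen]
  have hπe : ∀ i, π i (e i) = 0 := fun i => hπι i _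
  obtain ⟨l, hl⟩ : ∃ l : k, s (-c) = l • e (-c) := by
    have : s (-c) ∈ LinearMap.ker (π (-c)) := by
      rw [LinearMap.mem_ker, hπs _ (by omega), arcGen_eq_zero]
      rw [WithBot.coe_lt_coe]
      omega
    rw [(hex (-c)).2.2] at this
    obtain ⟨t, ht⟩ := this
    exact ⟨_, ht.symm.trans (hιe _ t)⟩
  have hsl : ∀ i, -c ≤ i → s i = l • e i := by
    intro i hi
    induction i, hi using Int.leInduction with
    | base => exact hl
    | succ i hi ih => rw [← hs i (by omega), ih, map_smul, he i (by omega)]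
  have hl0 : l ≠ 0 := by
    rintro rfl
    refine hnsplit ⟨_, isGrHom_arcVal_smulRight B s (fun i _ hi => ?_) (fun i hi => ?_), ?_⟩
    · rw [WithBot.coe_le_coe] at hi
      exact hs i (by omega)
    · rw [WithBot.coe_le_coe] at hi
      rw [hsl i (by omega), zero_smul]
    · intro i
      ext y
      simp only [LinearMap.comp_apply, LinearMap.smulRight_apply, map_smul, LinearMap.id_apply]
      by_cases hi : -d ≤ i
      · rw [hπs i hi, arcVal_smul_gen]
      · have hy : y = 0 := arcVal_injective (by
          rw [arcVal_eq_zero, map_zero]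
          rw [WithBot.coe_le_coe]
          omega)
        simp [hy]
  have hf := isGrHom_arcVal_smulRight (a := (c : Zb)) (b := (b : Zb)) B (fun i => l • e i - s i)
    (fun i _ hi => by
      rw [WithBot.coe_le_coe] at hi
      rw [map_sub, map_smul, he i (by omega), hs i (by omega)])
    (fun i hi => by
      rw [WithBot.coe_le_coe] at hi
      rw [hsl i (by omega), sub_self])
  have hg := isGrHom_arcVal_smulRight (a := a) (b := (d : Zb)) B s
    (fun i _ hi => by
      rw [WithBot.coe_le_coe] at hi
      exact hs i (by omega))
    (fun i hi => by
      have := hca i hi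
      rw [hsl i (by omega), hea i hi, smul_zero])
  have hval {i : ℤ} {r : k} (h : r • arcGen k c d i = 0) (h₁ : c < -i) (h₂ : -i ≤ d) : r = 0 := by
    have := congrArg (arcVal k c d i) h
    rwa [map_smul, arcVal_gen, map_zero, arcInd,
      if_pos ⟨WithBot.coe_lt_coe.2 h₁, WithBot.coe_le_coe.2 h₂⟩, smul_eq_mul, mul_one] at this
  have hvale {i : ℤ} {r : k} (h : r • e i = 0) (h₁ : a < ((-i : ℤ) : Zb)) (h₂ : -i ≤ b) :
      r = 0 := by
    rw [← map_smul] at h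
    have := congrArg (arcVal k a b i) ((hex i).1 (h.trans (map_zero _).symm))
    rwa [map_smul, arcVal_gen, map_zero, arcInd,
      if_pos ⟨h₁, WithBot.coe_le_coe.2 h₂⟩, smul_eq_mul, mul_one] at this
  refine nonempty_grIso_of_bijective (M := dsumMod k (arcMod k c b) (arcMod k a d))
    (f := fun i => LinearMap.coprod ((arcVal k c b i).smulRight (l • e i - s i))
      ((arcVal k a d i).smulRight (s i))) ?_ ?_
  · intro i
    refine LinearMap.ext fun ⟨p, q⟩ => ?_
    have h₁ := LinearMap.congr_fun (hf i) p
    have h₂ := LinearMap.congr_fun (hg i) q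
    simp only [LinearMap.comp_apply] at h₁ h₂
    exact (map_add (B.act i) _ _).trans (congrArg₂ (· + ·) h₁ h₂)
  · intro i
    constructor
    · refine (injective_iff_map_eq_zero _).2 fun ⟨p, q⟩ h => ?_
      replace h : arcVal k c b i p • (l • e i - s i) + arcVal k a d i q • s i = 0 := h
      suffices hpq : arcVal k c b i p = 0 ∧ arcVal k a d i q = 0 from
        Prod.ext (arcVal_injective (hpq.1.trans (map_zero _).symm))
          (arcVal_injective (hpq.2.trans (map_zero _).symm))
      by_cases hcb : c < -i ∧ -i ≤ b
      · have h' := congrArg (π i) h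
        simp only [map_add, map_smul, map_sub, hπe, hπs i (by omega), map_zero, smul_zero,
          zero_sub, smul_neg, ← neg_smul, ← add_smul] at h'
        have hqp := neg_add_eq_zero.1 (hval h' hcb.1 (by omega))
        rw [← hqp, smul_sub, sub_add_cancel, smul_smul] at h
        have hp := (mul_eq_zero.1 (hvale h (hac i hcb.1.le) hcb.2)).resolve_right hl0
        exact ⟨hp, hqp ▸ hp⟩
      · have hp : arcVal k c b i p = 0 :=
          arcVal_eq_zero (by rwa [WithBot.coe_lt_coe, WithBot.coe_le_coe]) p
        refine ⟨hp, ?_⟩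
        rw [hp, zero_smul, zero_add] at h
        by_cases had : a < ((-i : ℤ) : Zb) ∧ ((-i : ℤ) : Zb) ≤ (d : Zb)
        · have hd := WithBot.coe_le_coe.1 had.2
          by_cases hci : c < -i
          · have h' := congrArg (π i) h
            rw [map_smul, hπs i (by omega), map_zero] at h'
            exact hval h' hci hd
          · rw [hsl i (by omega), smul_smul] at h
            exact (mul_eq_zero.1 (hvale h had.1 (by omega))).resolve_right hl0
        · exact arcVal_eq_zero had q
    · intro z
      suffices ∃ p q, arcVal k c b i p • (l • e i - s i) + arcVal k a d i q • s i = z by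
        obtain ⟨p, q, h⟩ := this
        exact ⟨(p, q), h⟩
      obtain ⟨r, t, hz, hr, ht⟩ : ∃ r t : k, z = r • s i + t • e i ∧
          (¬(c < -i ∧ -i ≤ d) → r = 0) ∧
          (¬(a < ((-i : ℤ) : Zb) ∧ ((-i : ℤ) : Zb) ≤ (b : Zb)) → t = 0) := by
        have hr : ¬(c < -i ∧ -i ≤ d) → arcVal k c d i (π i z) = 0 := fun h =>
          arcVal_eq_zero (by rwa [WithBot.coe_lt_coe, WithBot.coe_le_coe]) _
        have : z - arcVal k c d i (π i z) • s i ∈ LinearMap.ker (π i) := by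
          rw [LinearMap.mem_ker, map_sub, map_smul, sub_eq_zero]
          by_cases hi : -d ≤ i
          · rw [hπs i hi, arcVal_smul_gen]
          · have h0 := hr (by omega)
            rw [h0, zero_smul]
            exact arcVal_injective (h0.trans (map_zero _).symm)
        rw [(hex i).2.2] at this
        obtain ⟨t, ht⟩ := this
        refine ⟨_, arcVal k a b i t, ?_, hr, fun h => arcVal_eq_zero h t⟩
        rw [← hιe, ht, add_sub_cancel]
      by_cases hcb : c < -i ∧ -i ≤ b
      · obtain ⟨p, hp⟩ := exists_arcVal_eq (k := k) (i := i) (a := (c : Zb)) (b := (b : Zb))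
          ⟨WithBot.coe_lt_coe.2 hcb.1, WithBot.coe_le_coe.2 hcb.2⟩ (t / l)
        obtain ⟨q, hq⟩ := exists_arcVal_eq (k := k) (i := i) (a := a) (b := (d : Zb))
          ⟨hac i hcb.1.le, WithBot.coe_le_coe.2 (by omega)⟩ (r + t / l)
        refine ⟨p, q, ?_⟩
        rw [hp, hq, hz, smul_sub, smul_smul, div_mul_cancel₀ _ hl0]
        module
      · suffices ∃ q, arcVal k a d i q • s i = z by
          obtain ⟨q, hq⟩ := this
          exact ⟨0, q, by rw [map_zero, zero_smul, zero_add, hq]⟩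
        by_cases had : a < ((-i : ℤ) : Zb) ∧ ((-i : ℤ) : Zb) ≤ (d : Zb)
        · have hd := WithBot.coe_le_coe.1 had.2
          by_cases hci : c < -i
          · obtain ⟨q, hq⟩ := exists_arcVal_eq (k := k) had r
            have h0 := ht (fun h => hcb ⟨hci, WithBot.coe_le_coe.1 h.2⟩)
            exact ⟨q, by rw [hq, hz, h0, zero_smul, add_zero]⟩
          · obtain ⟨q, hq⟩ := exists_arcVal_eq (k := k) had (t / l)
            refine ⟨q, ?_⟩
            rw [hq, hz, hr (fun h => hci h.1), hsl i (by omega), smul_smul,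
              div_mul_cancel₀ _ hl0, zero_smul, zero_add]
        · have h0 : t = 0 := ht fun h =>
            had ⟨h.1, h.2.trans (WithBot.coe_le_coe.2 h3.le)⟩
          have h0' : r = 0 := hr fun h =>
            had ⟨hac i h.1.le, WithBot.coe_le_coe.2 h.2⟩
          exact ⟨0, by rw [hz, h0, h0', map_zero]; simp⟩
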